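/- Let K be an algebraically closed field. If f ∈ K[[x,y]] is a non-degenerate, convenient and irreducible power series of bidegree (m,n) = (ord f(x,0), ord f(0,y)), then gcd(m,n) = 1. -/

import Mathlib

/-!
Common definitions for formalizing "A note on the plane curve singularities in
positive characteristic" by E. García Barroso and A. Płoski.

We work with the ring `K[[x,y]] := MvPowerSeries (Fin 2) K`, where `x` is the
variable of index `0` and `y` the variable of index `1`.
-/

open scoped Classical

noncomputable section

universe u

namespace PlaneCurveNote

/-- The formal power series ring `K[[x,y]]`. -/
abbrev PS (K : Type u) [Field K] := MvPowerSeries (Fin 2) K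

variable (K : Type u) [Field K]

/-- The variable `x`. -/
def Xv : PS K := MvPowerSeries.X 0

/-- The variable `y`. -/
def Yv : PS K := MvPowerSeries.X 1

/-- The coefficient `c_{αβ}` of `x^α y^β` in `f`. -/
def coef (f : PS K) (p : ℕ × ℕ) : K :=
  MvPowerSeries.coeff (R := K) (Finsupp.single 0 p.1 + Finsupp.single 1 p.2) f

/-- The support of a power series, as a subset of `ℕ²`. -/
def supp (f : PS K) : Set (ℕ × ℕ) := {p | coef K f p ≠ 0}

/-- Build a power series from a coefficient function on `ℕ²`. -/
def ofCoef (c : ℕ × ℕ → K) : PS K := fun d => c (d 0, d 1)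

/-- A reduced power series: nonzero, without constant term and without multiple factors. -/
def IsReducedSeries (f : PS K) : Prop :=
  f ≠ 0 ∧ MvPowerSeries.constantCoeff (σ := Fin 2) (R := K) f = 0 ∧ Squarefree f

/-- `r(f)`: the number of irreducible factors of `f` (counted up to associates,
i.e. the number of distinct irreducible components of the curve `f = 0` when `f` is reduced). -/
def numFactors (f : PS K) : ℕ :=
  Set.ncard {P : Associates (PS K) | Irreducible P ∧ P ∣ Associates.mk f}

/-- The local ring `O_f = K[[x,y]]/(f)` of the curve `f = 0`. -/
abbrev CurveRing (f : PS K) := PS K ⧸ Ideal.span ({f} : Set (PS K))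

/-- `deltaSpec K f d` expresses that `d = δ(f) = dim_K Ō_f/O_f`, where `Ō_f` is the integral
closure of `O_f = K[[x,y]]/(f)` in (any model `L` of) its total ring of fractions. -/
def deltaSpec (f : PS K) (d : ℕ) : Prop :=
  ∀ (L : Type u) [CommRing L] [Algebra K L] [Algebra (CurveRing K f) L]
    [IsScalarTower K (CurveRing K f) L] [IsFractionRing (CurveRing K f) L],
    letI N : Submodule K L := Submodule.span K ((integralClosure (CurveRing K f) L : Set L))
    letI P : Submodule K L := Submodule.span K (Set.range (algebraMap (CurveRing K f) L))
    d = Module.finrank K (↥N ⧸ (P.comap N.subtype))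

/-- `δ(f)`, the delta invariant of `f`. -/
def delta (f : PS K) : ℕ := sInf {d | deltaSpec K f d}

/-- `μ̄(f) = 2δ(f) - r(f) + 1`, the invariant Milnor number of `f`. -/
def muBar (f : PS K) : ℤ := 2 * (delta K f : ℤ) - (numFactors K f : ℤ) + 1

/-- `i₀(f,g) = dim_K K[[x,y]]/(f,g)`, the intersection multiplicity of `f` and `g`
(as a natural number; meaningful when it is finite). -/
def iMult (f g : PS K) : ℕ :=
  Module.finrank K (PS K ⧸ Ideal.span ({f, g} : Set (PS K)))

/-- `i₀(f,g)` as a cardinal (`dim_K K[[x,y]]/(f,g)`), allowing the infinite case. -/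
def iMultC (f g : PS K) : Cardinal :=
  Module.rank K (PS K ⧸ Ideal.span ({f, g} : Set (PS K)))

/-- `Γ(f)`: the semigroup of values of an irreducible `f`, i.e. the set of intersection
multiplicities `i₀(f,g)` where `g` runs over power series with `g ≢ 0 (mod f)`. -/
def valueSemigroup (f : PS K) : Set ℕ :=
  {n | ∃ g : PS K, ¬ f ∣ g ∧ n = iMult K f g}

/-- `ord f`, the order of a power series. -/
def ordSeries (f : PS K) : ℕ := sInf ((fun p => p.1 + p.2) '' supp K f)

/-- `m = ord f(x,0)`. -/
def ordX (f : PS K) : ℕ := sInf {a : ℕ | (a, 0) ∈ supp K f}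

/-- `n = ord f(0,y)`. -/
def ordY (f : PS K) : ℕ := sInf {b : ℕ | (0, b) ∈ supp K f}

/-- `f` is convenient if `f(x,0) f(0,y) ≠ 0`. -/
def Convenient (f : PS K) : Prop :=
  (∃ a : ℕ, (a, 0) ∈ supp K f) ∧ (∃ b : ℕ, (0, b) ∈ supp K f)

/-- A Newton edge: a segment with vertices `(α,β)`, `(α',β') ∈ ℕ²`, `α < α'`, `β' < β`. -/
structure NEdge : Type where
  A : ℕ × ℕ
  B : ℕ × ℕ
  hx : A.1 < B.1
  hy : B.2 < A.2

/-- `|S|₁ = α' - α`. -/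
def NEdge.len1 (S : NEdge) : ℕ := S.B.1 - S.A.1

/-- `|S|₂ = β - β'`. -/
def NEdge.len2 (S : NEdge) : ℕ := S.A.2 - S.B.2

/-- `r(S) = gcd(|S|₁, |S|₂)`. -/
def NEdge.rE (S : NEdge) : ℕ := Nat.gcd S.len1 S.len2

/-- The lattice points lying on the segment `S`. -/
def NEdge.mem (S : NEdge) (p : ℕ × ℕ) : Prop :=
  S.A.1 ≤ p.1 ∧ p.1 ≤ S.B.1 ∧ S.B.2 ≤ p.2 ∧ p.2 ≤ S.A.2 ∧
    (p.1 - S.A.1) * S.len2 = (S.A.2 - p.2) * S.len1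

/-- `[S,T] = min{|S|₁|T|₂, |S|₂|T|₁}`. -/
def bracket (S T : NEdge) : ℕ := min (S.len1 * T.len2) (S.len2 * T.len1)

/-- The Newton polygon `N_f` of `f`, described as the set of compact edges of the boundary of
the Newton diagram of `f`: an edge belongs to `N_f` iff its endpoints lie in the support of `f`
and some weight vector `w` with positive entries attains its minimum on the support of `f`
exactly on this segment. -/
def newtonPolygon (f : PS K) : Set NEdge :=
  {S | S.A ∈ supp K f ∧ S.B ∈ supp K f ∧
    ∃ w : ℕ × ℕ, 0 < w.1 ∧ 0 < w.2 ∧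
      w.1 * S.B.1 + w.2 * S.B.2 = w.1 * S.A.1 + w.2 * S.A.2 ∧
      (∀ p ∈ supp K f, w.1 * S.A.1 + w.2 * S.A.2 ≤ w.1 * p.1 + w.2 * p.2) ∧
      (∀ p ∈ supp K f, w.1 * p.1 + w.2 * p.2 = w.1 * S.A.1 + w.2 * S.A.2 →
        S.A.1 ≤ p.1 ∧ p.1 ≤ S.B.1)}

/-- `|N_f|₁ = Σ_{S ∈ N_f} |S|₁`. -/
def len1N (f : PS K) : ℕ := ∑ᶠ S ∈ newtonPolygon K f, S.len1

/-- `|N_f|₂ = Σ_{S ∈ N_f} |S|₂`. -/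
def len2N (f : PS K) : ℕ := ∑ᶠ S ∈ newtonPolygon K f, S.len2

/-- `[N_f, N_f] = Σ_{S,T ∈ N_f} [S,T]`. -/
def bracketN (f : PS K) : ℕ := ∑ᶠ S ∈ newtonPolygon K f, ∑ᶠ T ∈ newtonPolygon K f, bracket S T

/-- `k`: the exponent of the highest power of `x` dividing `f`. -/
def kdiv (f : PS K) : ℕ := sInf {a : ℕ | ∃ b : ℕ, (a, b) ∈ supp K f}

/-- `l`: the exponent of the highest power of `y` dividing `f`. -/
def ldiv (f : PS K) : ℕ := sInf {b : ℕ | ∃ a : ℕ, (a, b) ∈ supp K f}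

/-- `r(N_f) = Σ_{S ∈ N_f} r(S) + k + l`, where `x^k y^l` is the monomial of highest degree
dividing `f`. -/
def rNewton (f : PS K) : ℕ := (∑ᶠ S ∈ newtonPolygon K f, S.rE) + kdiv K f + ldiv K f

/-- `μ(N_f) = [N_f,N_f] - |N_f|₁ - |N_f|₂ + 1` (the Newton number of a convenient series). -/
def muNewtonConv (f : PS K) : ℤ :=
  (bracketN K f : ℤ) - (len1N K f : ℤ) - (len2N K f : ℤ) + 1

/-- `μ(N_f) = sup_{m ∈ ℕ} μ(N_{f + x^m + y^m})`: the Newton number of an arbitrary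
(reduced) power series. -/
def muNewton (f : PS K) : ℤ :=
  sSup {z : ℤ | ∃ m : ℕ, z = muNewtonConv K (f + Xv K ^ m + Yv K ^ m)}

/-- `δ(N_f) = (μ(N_f) + r(N_f) - 1)/2`. -/
def deltaNewton (f : PS K) : ℤ := (muNewton K f + (rNewton K f : ℤ) - 1) / 2

/-- `in(f,S) = Σ_{(α,β) ∈ S} c_{αβ} x^α y^β`, the initial part of `f` along the edge `S`. -/
def initialForm (f : PS K) (S : NEdge) : PS K :=
  ofCoef K fun p => if S.mem p then coef K f p else 0

/-- `ī(f,S)`: the convenient power series with `in(f,S) = x^{α(S)} y^{β(S)} ī(f,S)`,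
where `x^{α(S)} y^{β(S)}` is the monomial of highest degree dividing `in(f,S)`. -/
def inBar (f : PS K) (S : NEdge) : PS K :=
  ofCoef K fun p =>
    if S.mem (p.1 + S.A.1, p.2 + S.B.2) then coef K f (p.1 + S.A.1, p.2 + S.B.2) else 0

/-- `f` is non-degenerate (in the sense of Beelen–Pellikaan) if `ī(f,S)` is reduced
(i.e. squarefree) for every edge `S ∈ N_f`. -/
def NonDegenerate (f : PS K) : Prop :=
  ∀ S ∈ newtonPolygon K f, Squarefree (inBar K f S)

/-- `f` is elementary if it is convenient and `N_f` consists of a single edge. -/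
def Elementary (f : PS K) : Prop :=
  Convenient K f ∧ ∃ S : NEdge, newtonPolygon K f = {S}

/-- Evaluation of a power series with finite support (e.g. an initial form) at a point of `K²`. -/
def psEval (f : PS K) (v : K × K) : K :=
  ∑ᶠ p : ℕ × ℕ, coef K f p * v.1 ^ p.1 * v.2 ^ p.2

/-- The partial derivative `∂f/∂x` (for `i = 0`) resp. `∂f/∂y` (for `i = 1`). -/
def pderivSeries (i : Fin 2) (f : PS K) : PS K :=
  ofCoef K fun p =>
    if i = 0 then ((p.1 + 1 : ℕ) : K) * coef K f (p.1 + 1, p.2)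
    else ((p.2 + 1 : ℕ) : K) * coef K f (p.1, p.2 + 1)

/-- `μ(f) = i₀(∂f/∂x, ∂f/∂y)`, the Milnor number of `f`. -/
def milnor (f : PS K) : ℕ := iMult K (pderivSeries K 0 f) (pderivSeries K 1 f)

/-- `f` is strongly non-degenerate (Kouchnirenko) if for every `S ∈ N_f` the solutions of
`∂in(f,S)/∂x = ∂in(f,S)/∂y = 0` are contained in `{xy = 0}`. -/
def StronglyNonDegenerate (f : PS K) : Prop :=
  ∀ S ∈ newtonPolygon K f, ∀ v : K × K,
    psEval K (pderivSeries K 0 (initialForm K f S)) v = 0 →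
    psEval K (pderivSeries K 1 (initialForm K f S)) v = 0 → v.1 * v.2 = 0

/-- The Newton diagram `Δ(f) ⊆ ℝ²`: the convex hull of `supp f + (ℝ_{≥0})²`. -/
def diagram (f : PS K) : Set (ℝ × ℝ) :=
  convexHull ℝ {q : ℝ × ℝ | ∃ p ∈ supp K f, (p.1 : ℝ) ≤ q.1 ∧ (p.2 : ℝ) ≤ q.2}

/-- A real point lies on the Newton polygon `N_f` (i.e. on a compact face of the boundary of
the Newton diagram) iff it belongs to the diagram and some linear form with positive
coefficients attains its minimum over the diagram at this point. -/
def OnNewtonPolygon (f : PS K) (q : ℝ × ℝ) : Prop :=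
  q ∈ diagram K f ∧ ∃ w : ℝ × ℝ, 0 < w.1 ∧ 0 < w.2 ∧
    ∀ p ∈ diagram K f, w.1 * q.1 + w.2 * q.2 ≤ w.1 * p.1 + w.2 * p.2

section Coefficients

variable {K}

lemma coef_ofCoef (c : ℕ × ℕ → K) (p : ℕ × ℕ) : coef K (ofCoef K c) p = c p := by
  simp [coef, ofCoef, MvPowerSeries.coeff_apply]

lemma single_add_single_eq (d : Fin 2 →₀ ℕ) :
    Finsupp.single 0 (d 0) + Finsupp.single 1 (d 1) = d := by
  ext i
  fin_cases i <;> simp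

lemma ext_coef {f g : PS K} (h : ∀ p, coef K f p = coef K g p) : f = g := by
  ext d
  simpa only [coef, single_add_single_eq] using h (d 0, d 1)

lemma coef_add (f g : PS K) (p : ℕ × ℕ) : coef K (f + g) p = coef K f p + coef K g p := by
  simp [coef]

lemma coef_sub (f g : PS K) (p : ℕ × ℕ) : coef K (f - g) p = coef K f p - coef K g p := by
  simp [coef]

lemma coef_mul (f g : PS K) (i j : ℕ) :
    coef K (f * g) (i, j) = ∑ y ∈ Finset.HasAntidiagonal.antidiagonal j,
      ∑ x ∈ Finset.HasAntidiagonal.antidiagonal i,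
      coef K f (x.1, y.1) * coef K g (x.2, y.2) := by
  rw [coef, MvPowerSeries.coeff_mul, ← Finset.sum_product']
  refine Finset.sum_nbij' (fun d => ((d.1 1, d.2 1), (d.1 0, d.2 0)))
    (fun z => (Finsupp.single 0 z.2.1 + Finsupp.single 1 z.1.1,
      Finsupp.single 0 z.2.2 + Finsupp.single 1 z.1.2)) ?_ ?_ ?_ ?_ ?_
  · rintro ⟨a, b⟩ h
    rw [Finset.HasAntidiagonal.mem_antidiagonal] at h
    have h0 := DFunLike.congr_fun h 0
    have h1 := DFunLike.congr_fun h 1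
    simp at h0 h1
    simp [h0, h1]
  · rintro ⟨⟨a, b⟩, ⟨c, d⟩⟩ h
    simp only [Finset.mem_product, Finset.HasAntidiagonal.mem_antidiagonal] at h ⊢
    obtain ⟨rfl, rfl⟩ := h
    ext i
    fin_cases i <;> simp
  · rintro ⟨a, b⟩ -
    simp only [single_add_single_eq]
  · rintro ⟨⟨a, b⟩, ⟨c, d⟩⟩ -
    simp
  · rintro ⟨a, b⟩ -
    simp only [coef, single_add_single_eq]

lemma coef_zero_eq_constantCoeff (f : PS K) :
    coef K f (0, 0) = MvPowerSeries.constantCoeff f := by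
  simp [coef]

lemma isUnit_iff_coef_zero_ne_zero (f : PS K) : IsUnit f ↔ coef K f (0, 0) ≠ 0 := by
  rw [MvPowerSeries.isUnit_iff_constantCoeff, coef_zero_eq_constantCoeff, isUnit_iff_ne_zero]

end Coefficients

section WeightedOrder

variable {K} {w₁ w₂ : ℕ}

/-- Every monomial of `f` has weight at least `N` for the weights `(w₁, w₂)`. -/
def WeightGE (w₁ w₂ N : ℕ) (f : PS K) : Prop :=
  ∀ i j, w₁ * i + w₂ * j < N → coef K f (i, j) = 0

lemma WeightGE.mono {N M : ℕ} {f : PS K} (hf : WeightGE w₁ w₂ N f) (h : M ≤ N) :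
    WeightGE w₁ w₂ M f := fun i j hij => hf i j (hij.trans_le h)

lemma WeightGE.add {N : ℕ} {f g : PS K} (hf : WeightGE w₁ w₂ N f) (hg : WeightGE w₁ w₂ N g) :
    WeightGE w₁ w₂ N (f + g) := fun i j hij => by
  rw [coef_add, hf i j hij, hg i j hij, add_zero]

lemma WeightGE.sub {N : ℕ} {f g : PS K} (hf : WeightGE w₁ w₂ N f) (hg : WeightGE w₁ w₂ N g) :
    WeightGE w₁ w₂ N (f - g) := fun i j hij => by
  rw [coef_sub, hf i j hij, hg i j hij, sub_zero]

lemma WeightGE.mul {N M : ℕ} {f g : PS K} (hf : WeightGE w₁ w₂ N f) (hg : WeightGE w₁ w₂ M g) :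
    WeightGE w₁ w₂ (N + M) (f * g) := fun i j hij => by
  rw [coef_mul]
  refine Finset.sum_eq_zero fun ⟨b, d⟩ hj => Finset.sum_eq_zero fun ⟨a, c⟩ hi => ?_
  rw [Finset.HasAntidiagonal.mem_antidiagonal] at hi hj
  subst hi hj
  dsimp only at hij ⊢
  by_cases h1 : w₁ * a + w₂ * b < N
  · simp [hf a b h1]
  · have h2 : w₁ * c + w₂ * d < M := by
      rw [mul_add, mul_add] at hij
      omega
    simp [hg c d h2]

lemma WeightGE.not_isUnit {N : ℕ} {f : PS K} (hf : WeightGE w₁ w₂ N f) (hN : 0 < N) :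
    ¬ IsUnit f := by
  rw [isUnit_iff_coef_zero_ne_zero, not_not]
  exact hf 0 0 (by simpa using hN)

/-- The part of weight `N` with prescribed dehomogenization `p` (monomials of `p` that are not
the dehomogenization of a monomial of weight `N` are discarded). -/
def homogenize (w₁ w₂ N : ℕ) (p : Polynomial K) : PS K :=
  ofCoef K fun q => if w₁ * q.1 + w₂ * q.2 = N then p.coeff q.2 else 0

lemma coef_homogenize (N : ℕ) (p : Polynomial K) (i j : ℕ) :
    coef K (homogenize w₁ w₂ N p) (i, j) = if w₁ * i + w₂ * j = N then p.coeff j else 0 :=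
  coef_ofCoef _ _

lemma weightGE_homogenize (N : ℕ) (p : Polynomial K) :
    WeightGE w₁ w₂ N (homogenize w₁ w₂ N p) := fun i j hij => by
  rw [coef_homogenize, if_neg hij.ne]

lemma homogenize_add (N : ℕ) (p q : Polynomial K) :
    homogenize w₁ w₂ N (p + q) = homogenize w₁ w₂ N p + homogenize w₁ w₂ N q := by
  refine ext_coef fun ⟨i, j⟩ => ?_
  simp only [coef_add, coef_homogenize, Polynomial.coeff_add]
  split_ifs <;> simp

/-- Every monomial of `p` is the dehomogenization of a monomial of weight `N`. -/
def IsDehomogenized (w₁ w₂ N : ℕ) (p : Polynomial K) : Prop :=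
  ∀ j, p.coeff j ≠ 0 → ∃ i, w₁ * i + w₂ * j = N

lemma homogenize_mul (hw₁ : 0 < w₁) {N M : ℕ} {p q : Polynomial K}
    (hp : IsDehomogenized w₁ w₂ N p) (hq : w₂ * q.natDegree ≤ M) :
    homogenize w₁ w₂ (N + M) (p * q) = homogenize w₁ w₂ N p * homogenize w₁ w₂ M q := by
  refine ext_coef fun ⟨i, j⟩ => ?_
  by_cases hij : w₁ * i + w₂ * j = N + M
  · rw [coef_homogenize, if_pos hij, coef_mul, Polynomial.coeff_mul]
    refine Finset.sum_congr rfl fun ⟨b, d⟩ hj => ?_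
    rw [Finset.HasAntidiagonal.mem_antidiagonal] at hj
    simp only [coef_homogenize]
    by_cases hb : p.coeff b = 0
    · simp [hb]
    by_cases hd : q.coeff d = 0
    · simp [hd]
    obtain ⟨a, ha⟩ := hp b hb
    have hdM : w₂ * d ≤ M :=
      (Nat.mul_le_mul_left _ (Polynomial.le_natDegree_of_ne_zero hd)).trans hq
    subst hj
    dsimp only at hij
    rw [mul_add] at hij
    have hai : a ≤ i := Nat.le_of_mul_le_mul_left (by omega) hw₁
    obtain ⟨c, rfl⟩ := Nat.exists_eq_add_of_le hai
    rw [mul_add] at hij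
    rw [Finset.sum_eq_single (a, c), if_pos ha, if_pos (by dsimp only; omega)]
    · rintro ⟨a', c'⟩ h hne
      rw [Finset.HasAntidiagonal.mem_antidiagonal] at h
      rw [if_neg, zero_mul]
      intro ha'
      dsimp only at ha' h
      have : a' = a := Nat.eq_of_mul_eq_mul_left hw₁ (by omega)
      exact hne (by ext <;> simp <;> omega)
    · simp
  · rw [coef_homogenize, if_neg hij, coef_mul]
    symm
    refine Finset.sum_eq_zero fun ⟨b, d⟩ hj => Finset.sum_eq_zero fun ⟨a, c⟩ hi => ?_
    rw [Finset.HasAntidiagonal.mem_antidiagonal] at hi hj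
    subst hi hj
    dsimp only at hij ⊢
    simp only [coef_homogenize]
    split_ifs with h1 h2
    · exact absurd (by rw [← h1, ← h2]; ring) hij
    all_goals simp

lemma exists_dehomogenize (hw₁ : 0 < w₁) (hw₂ : 0 < w₂) (N : ℕ) (e : PS K) :
    ∃ p : Polynomial K, IsDehomogenized w₁ w₂ N p ∧
      ∀ i j, w₁ * i + w₂ * j = N → p.coeff j = coef K e (i, j) := by
  let c : ℕ → K := fun j => if h : ∃ i, w₁ * i + w₂ * j = N then coef K e (h.choose, j) else 0
  have hc (j : ℕ) : (∑ l ∈ Finset.range (N + 1), Polynomial.monomial l (c l)).coeff j = c j := by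
    rw [Polynomial.finsetSum_coeff]
    simp only [Polynomial.coeff_monomial, Finset.sum_ite_eq', Finset.mem_range]
    split_ifs with h
    · rfl
    · simp only [c]
      rw [dif_neg]
      rintro ⟨i, hi⟩
      nlinarith
  refine ⟨∑ l ∈ Finset.range (N + 1), Polynomial.monomial l (c l), fun j hj => ?_,
    fun i j hij => ?_⟩
  · by_contra h
    exact hj (by rw [hc]; exact dif_neg h)
  · have h : ∃ i, w₁ * i + w₂ * j = N := ⟨i, hij⟩
    have hi : h.choose = i :=
      Nat.eq_of_mul_eq_mul_left hw₁ (Nat.add_right_cancel (h.choose_spec.trans hij.symm))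
    rw [hc]
    simp only [c, dif_pos h, hi]

lemma IsDehomogenized.mul_natDegree_le {N : ℕ} {p : Polynomial K}
    (hp : IsDehomogenized w₁ w₂ N p) : w₂ * p.natDegree ≤ N := by
  by_cases h : p = 0
  · simp [h]
  · obtain ⟨i, hi⟩ := hp p.natDegree (by simpa using h)
    omega

lemma weightGE_sub_homogenize {N : ℕ} {e : PS K} (he : WeightGE w₁ w₂ N e) {p : Polynomial K}
    (hp : ∀ i j, w₁ * i + w₂ * j = N → p.coeff j = coef K e (i, j)) :
    WeightGE w₁ w₂ (N + 1) (e - homogenize w₁ w₂ N p) := fun i j hij => by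
  rw [coef_sub, coef_homogenize]
  split_ifs with h
  · rw [hp i j h, sub_self]
  · rw [he i j (by omega), sub_zero]

lemma eq_of_forall_weightGE_sub {f g : PS K} (h : ∀ N, WeightGE w₁ w₂ N (f - g)) : f = g := by
  refine ext_coef fun ⟨i, j⟩ => ?_
  have := h (w₁ * i + w₂ * j + 1) i j (Nat.lt_succ_self _)
  rwa [coef_sub, sub_eq_zero] at this

/-- Completeness of `K[[x,y]]` for the filtration by weight. -/
lemma exists_limit (g : ℕ → PS K) (hg : ∀ k, WeightGE w₁ w₂ k (g (k + 1) - g k)) :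
    ∃ l : PS K, ∀ k, WeightGE w₁ w₂ k (l - g k) := by
  have key (k n : ℕ) : WeightGE w₁ w₂ k (g (k + n) - g k) := by
    induction n with
    | zero => intro i j _; simp [coef]
    | succ n ih =>
      have := ((hg (k + n)).mono (Nat.le_add_right k n)).add ih
      rwa [sub_add_sub_cancel, add_assoc] at this
  refine ⟨ofCoef K fun p => coef K (g (w₁ * p.1 + w₂ * p.2 + 1)) p, fun k i j hij => ?_⟩
  rw [coef_sub, coef_ofCoef]
  obtain ⟨n, rfl⟩ := Nat.exists_eq_add_of_le (Nat.succ_le_of_lt hij)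
  have := key (w₁ * i + w₂ * j + 1) n i j (Nat.lt_succ_self _)
  rw [coef_sub, sub_eq_zero] at this
  rw [sub_eq_zero]
  exact this.symm

/-- Bézout's identity for coprime polynomials with control of the degrees. -/
lemma exists_mul_add_mul_eq {G H : Polynomial K} (hGH : IsCoprime G H) (hG : G.natDegree ≠ 0)
    (E : Polynomial K) : ∃ u v : Polynomial K, G * u + H * v = E ∧ v.natDegree ≤ G.natDegree ∧
      G.natDegree + u.natDegree ≤ max E.natDegree (G.natDegree + H.natDegree) := by
  obtain ⟨a, b, hab⟩ := hGH
  have hdiv := EuclideanDomain.div_add_mod (E * b) G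
  have hv : (E * b % G).natDegree ≤ G.natDegree := (Polynomial.natDegree_mod_lt _ hG).le
  have hsum : G * (E * a + H * (E * b / G)) + H * (E * b % G) = E := by
    linear_combination E * hab + H * hdiv
  refine ⟨E * a + H * (E * b / G), E * b % G, hsum, hv, ?_⟩
  by_cases hu : E * a + H * (E * b / G) = 0
  · rw [hu]
    simp
  · have hG0 : G ≠ 0 := by
      rintro rfl
      simp at hG
    rw [← Polynomial.natDegree_mul hG0 hu, eq_sub_of_add_eq hsum]
    refine (Polynomial.natDegree_sub_le _ _).trans (max_le_max le_rfl ?_)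
    refine Polynomial.natDegree_mul_le.trans ?_
    omega

/-- The linearized factorization problem, solved up to terms of higher weight. -/
lemma exists_linear_correction (hw₁ : 0 < w₁) (hw₂ : 0 < w₂) {G H : Polynomial K}
    (hGH : IsCoprime G H) (hG : G.natDegree ≠ 0)
    (hG' : IsDehomogenized w₁ w₂ (w₂ * G.natDegree) G)
    (hH' : IsDehomogenized w₁ w₂ (w₂ * H.natDegree) H) (k : ℕ) (e : PS K)
    (he : WeightGE w₁ w₂ (w₂ * G.natDegree + w₂ * H.natDegree + k) e) :
    ∃ u v : PS K, WeightGE w₁ w₂ (w₂ * H.natDegree + k) u ∧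
      WeightGE w₁ w₂ (w₂ * G.natDegree + k) v ∧
      WeightGE w₁ w₂ (w₂ * G.natDegree + w₂ * H.natDegree + k + 1)
        (e - (homogenize w₁ w₂ (w₂ * G.natDegree) G * u +
          homogenize w₁ w₂ (w₂ * H.natDegree) H * v)) := by
  obtain ⟨E, hE, hEe⟩ :=
    exists_dehomogenize hw₁ hw₂ (w₂ * G.natDegree + w₂ * H.natDegree + k) e
  obtain ⟨u, v, huv, hv, hu⟩ := exists_mul_add_mul_eq hGH hG E
  refine ⟨homogenize w₁ w₂ (w₂ * H.natDegree + k) u, homogenize w₁ w₂ (w₂ * G.natDegree + k) v,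
    weightGE_homogenize _ _, weightGE_homogenize _ _, ?_⟩
  have hu' : w₂ * u.natDegree ≤ w₂ * H.natDegree + k := by
    have hE' := hE.mul_natDegree_le
    rcases le_max_iff.1 hu with h | h <;>
    · have h' := Nat.mul_le_mul_left w₂ h
      simp only [mul_add] at h'
      omega
  have hv' : w₂ * v.natDegree ≤ w₂ * G.natDegree + k :=
    (Nat.mul_le_mul_left w₂ hv).trans (Nat.le_add_right _ _)
  rw [← homogenize_mul hw₁ hG' hu', ← homogenize_mul hw₁ hH' hv',
    show w₂ * H.natDegree + (w₂ * G.natDegree + k) = w₂ * G.natDegree + (w₂ * H.natDegree + k) by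
      ring, ← homogenize_add, huv, ← add_assoc]
  exact weightGE_sub_homogenize he hEe

/-- Hensel's lemma for weighted initial forms: a factorization of the initial form into coprime
quasi-homogeneous factors lifts to a factorization of the power series. -/
theorem exists_factorization (hw₁ : 0 < w₁) (hw₂ : 0 < w₂) {G H : Polynomial K}
    (hGH : IsCoprime G H) (hG : G.natDegree ≠ 0)
    (hG' : IsDehomogenized w₁ w₂ (w₂ * G.natDegree) G)
    (hH' : IsDehomogenized w₁ w₂ (w₂ * H.natDegree) H) (f : PS K)
    (hf : WeightGE w₁ w₂ (w₂ * G.natDegree + w₂ * H.natDegree) f)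
    (hfGH : ∀ i j, w₁ * i + w₂ * j = w₂ * G.natDegree + w₂ * H.natDegree →
      (G * H).coeff j = coef K f (i, j)) :
    ∃ g h : PS K, f = g * h ∧ WeightGE w₁ w₂ (w₂ * G.natDegree) g ∧
      WeightGE w₁ w₂ (w₂ * H.natDegree) h := by
  set a := w₂ * G.natDegree with ha
  set b := w₂ * H.natDegree with hb
  set G₀ := homogenize w₁ w₂ a G with hG₀
  set H₀ := homogenize w₁ w₂ b H with hH₀
  have hG₀a : WeightGE w₁ w₂ a G₀ := weightGE_homogenize _ _
  have hH₀b : WeightGE w₁ w₂ b H₀ := weightGE_homogenize _ _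
  let Approx (k : ℕ) (q : PS K × PS K) : Prop :=
    WeightGE w₁ w₂ (a + 1) (q.1 - G₀) ∧ WeightGE w₁ w₂ (b + 1) (q.2 - H₀) ∧
      WeightGE w₁ w₂ (a + b + (k + 1)) (f - q.1 * q.2)
  have step (k : ℕ) (q : PS K × PS K) (hq : Approx k q) : ∃ q', Approx (k + 1) q' ∧
      WeightGE w₁ w₂ (a + (k + 1)) (q'.1 - q.1) ∧ WeightGE w₁ w₂ (b + (k + 1)) (q'.2 - q.2) := by
    obtain ⟨h1, h2, h3⟩ := hq
    obtain ⟨u, v, hu, hv, huv⟩ := exists_linear_correction hw₁ hw₂ hGH hG hG' hH' (k + 1) _ h3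
    refine ⟨(q.1 + v, q.2 + u), ⟨?_, ?_, ?_⟩, by simpa using hv, by simpa using hu⟩
    · rw [add_sub_right_comm]
      exact h1.add (hv.mono (by omega))
    · rw [add_sub_right_comm]
      exact h2.add (hu.mono (by omega))
    · have e1 := (h1.mul hu).mono (show a + b + (k + 1 + 1) ≤ _ by omega)
      have e2 := (h2.mul hv).mono (show a + b + (k + 1 + 1) ≤ _ by omega)
      have e3 := (hv.mul hu).mono (show a + b + (k + 1 + 1) ≤ _ by omega)
      have := ((huv.sub e1).sub e2).sub e3
      rw [← ha, ← hb, ← hG₀, ← hH₀] at this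
      convert this using 1
      · ring
      · dsimp only
        ring
  have base : Approx 0 (G₀, H₀) := by
    have hmul : homogenize w₁ w₂ (a + b) (G * H) = G₀ * H₀ :=
      homogenize_mul hw₁ hG' le_rfl
    refine ⟨fun i j _ => by simp [coef], fun i j _ => by simp [coef], ?_⟩
    simp only [← hmul]
    exact weightGE_sub_homogenize hf hfGH
  choose! next hnext using step
  let s : ℕ → PS K × PS K := fun k => Nat.rec (G₀, H₀) next k
  have hs (k : ℕ) : Approx k (s k) := by
    induction k with
    | zero => exact base
    | succ k ih => exact (hnext k _ ih).1
  obtain ⟨g, hg⟩ := exists_limit (w₁ := w₁) (w₂ := w₂) (fun k => (s k).1)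
    fun k => (hnext k _ (hs k)).2.1.mono (by omega)
  obtain ⟨h, hh⟩ := exists_limit (w₁ := w₁) (w₂ := w₂) (fun k => (s k).2)
    fun k => (hnext k _ (hs k)).2.2.mono (by omega)
  have hsa (k : ℕ) : WeightGE w₁ w₂ a (s k).1 := by
    simpa using ((hs k).1.mono (Nat.le_succ a)).add hG₀a
  have hsb (k : ℕ) : WeightGE w₁ w₂ b (s k).2 := by
    simpa using ((hs k).2.1.mono (Nat.le_succ b)).add hH₀b
  refine ⟨g, h, eq_of_forall_weightGE_sub (w₁ := w₁) (w₂ := w₂) fun N => ?_,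
    by simpa using (hg a).add (hsa a), by simpa using (hh b).add (hsb b)⟩
  have hzero (q : PS K) : WeightGE w₁ w₂ 0 q := fun i j hij => absurd hij (Nat.not_lt_zero _)
  have e1 := (hs N).2.2.mono (show N ≤ _ by omega)
  have e2 := ((hg N).mul (hzero h)).mono (show N ≤ _ by omega)
  have e3 := ((hh N).mul (hzero (s N).1)).mono (show N ≤ _ by omega)
  convert (e1.sub e2).sub e3 using 1
  ring

theorem not_irreducible_of_coprime_initial (hw₁ : 0 < w₁) (hw₂ : 0 < w₂) {G H : Polynomial K}
    (hGH : IsCoprime G H) (hG : G.natDegree ≠ 0) (hH : H.natDegree ≠ 0)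
    (hG' : IsDehomogenized w₁ w₂ (w₂ * G.natDegree) G)
    (hH' : IsDehomogenized w₁ w₂ (w₂ * H.natDegree) H) (f : PS K)
    (hf : WeightGE w₁ w₂ (w₂ * G.natDegree + w₂ * H.natDegree) f)
    (hfGH : ∀ i j, w₁ * i + w₂ * j = w₂ * G.natDegree + w₂ * H.natDegree →
      (G * H).coeff j = coef K f (i, j)) : ¬ Irreducible f := by
  obtain ⟨g, h, rfl, hg, hh⟩ := exists_factorization hw₁ hw₂ hGH hG hG' hH' f hf hfGH
  intro hirr
  rcases hirr.isUnit_or_isUnit rfl with hu | hu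
  · exact hg.not_isUnit (by positivity) hu
  · exact hh.not_isUnit (by positivity) hu

end WeightedOrder

section FirstEdge

/-- The edge of the Newton polygon starting on the vertical axis. -/
lemma exists_first_edge {s : Set (ℕ × ℕ)} {m n : ℕ} (hm : (m, 0) ∈ s) (hn0 : 0 < n)
    (hn : ∀ b, (0, b) ∈ s → n ≤ b) :
    ∃ α β c, 0 < α ∧ 0 < c ∧ β + c = n ∧ (α, β) ∈ s ∧
      ∀ i j, (i, j) ∈ s → α * n ≤ c * i + α * j ∧ (c * i + α * j = α * n → i ≤ α) := by
  let slope : ℕ × ℕ → ℚ := fun p => (p.1 : ℚ) / ((n - p.2 : ℕ) : ℚ)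
  let T : Finset (ℕ × ℕ) := (Finset.range (m + 1) ×ˢ Finset.range n).filter (· ∈ s)
  have hT (p : ℕ × ℕ) : p ∈ T ↔ (p.1 < m + 1 ∧ p.2 < n) ∧ p ∈ s := by simp [T]
  have hmT : (m, 0) ∈ T := (hT _).2 ⟨⟨Nat.lt_succ_self m, hn0⟩, hm⟩
  obtain ⟨p₀, hp₀, hmin⟩ := T.exists_min_image slope ⟨_, hmT⟩
  obtain ⟨⟨α, β⟩, hp, hmax⟩ := (T.filter (slope · = slope p₀)).exists_max_image Prod.fst
    ⟨p₀, Finset.mem_filter.2 ⟨hp₀, rfl⟩⟩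
  obtain ⟨hpT, hps⟩ := Finset.mem_filter.1 hp
  obtain ⟨⟨-, hβ⟩, hαβ⟩ := (hT _).1 hpT
  obtain ⟨c, hc⟩ := Nat.exists_eq_add_of_lt hβ
  simp only at hc hβ
  have hcn : n - β = c + 1 := by omega
  have hslope (i j e : ℕ) (hij : (i, j) ∈ T) (he : j + e = n) (he0 : 0 < e) :
      α * e ≤ i * (c + 1) ∧ (α * e = i * (c + 1) → i ≤ α) := by
    have hje : n - j = e := by omega
    have hc0 : (0 : ℚ) < ((c + 1 : ℕ) : ℚ) := by positivity
    have he0' : (0 : ℚ) < (e : ℚ) := by positivity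
    constructor
    · have h := hmin _ hij
      rw [← hps] at h
      simp only [slope, hcn, hje] at h
      rw [div_le_div_iff₀ hc0 he0'] at h
      exact_mod_cast h
    · intro h
      refine hmax (i, j) (Finset.mem_filter.2 ⟨hij, ?_⟩)
      rw [← hps]
      simp only [slope, hcn, hje]
      rw [div_eq_div_iff he0'.ne' hc0.ne']
      exact_mod_cast h.symm
  have hα : 0 < α := by
    rcases Nat.eq_zero_or_pos α with rfl | h
    · have := hn _ hαβ
      omega
    · exact h
  refine ⟨α, β, c + 1, hα, Nat.succ_pos c, by omega, hαβ, fun i j hij => ?_⟩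
  rcases le_or_gt n j with hj | hj
  · have h1 : α * n ≤ α * j := Nat.mul_le_mul_left α hj
    refine ⟨by omega, fun h => ?_⟩
    have h2 : (c + 1) * i = 0 := by omega
    rcases Nat.mul_eq_zero.1 h2 with h3 | h3 <;> omega
  · obtain ⟨e, he⟩ := Nat.exists_eq_add_of_le hj.le
    rcases le_or_gt i m with him | him
    · obtain ⟨h1, h2⟩ :=
        hslope i j e ((hT _).2 ⟨⟨Nat.lt_succ_of_le him, hj⟩, hij⟩) he.symm (by omega)
      have h3 : α * n = α * j + α * e := by rw [he, mul_add]
      have h4 : (c + 1) * i = i * (c + 1) := mul_comm _ _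
      exact ⟨by omega, fun h => h2 (by omega)⟩
    · have h1 := (hslope m 0 n hmT (by omega) hn0).1
      have h2 : m * (c + 1) < (c + 1) * i := by
        rw [mul_comm]
        exact Nat.mul_lt_mul_of_pos_left him (Nat.succ_pos c)
      exact ⟨by omega, fun h => by omega⟩

end FirstEdge

section Irreducible

variable {K}

lemma weightGE_of_forall_mem_supp {f : PS K} {w₁ w₂ N : ℕ}
    (h : ∀ i j, (i, j) ∈ supp K f → N ≤ w₁ * i + w₂ * j) : WeightGE w₁ w₂ N f :=
  fun i j hij => by
    by_contra hne
    exact (h i j hne).not_gt hij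

/-- If the first edge of the Newton polygon does not reach the horizontal axis, then the series
is reducible. -/
lemma not_irreducible_of_first_edge {f : PS K} {α β c : ℕ} (hα : 0 < α) (hc : 0 < c)
    (hβ : 0 < β) (hn : (0, β + c) ∈ supp K f) (hαβ : (α, β) ∈ supp K f)
    (hedge : ∀ i j, (i, j) ∈ supp K f → α * (β + c) ≤ c * i + α * j ∧
      (c * i + α * j = α * (β + c) → i ≤ α)) : ¬ Irreducible f := by
  obtain ⟨P, hP, hPf⟩ := exists_dehomogenize hc hα (α * (β + c)) f
  have hPβ : P.coeff β ≠ 0 := by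
    rw [hPf α β (by ring)]
    exact hαβ
  have hPn : P.coeff (β + c) ≠ 0 := by
    rw [hPf 0 (β + c) (by ring)]
    exact hn
  have hPdeg : P.natDegree = β + c :=
    le_antisymm (Nat.le_of_mul_le_mul_left hP.mul_natDegree_le hα)
      (Polynomial.le_natDegree_of_ne_zero hPn)
  obtain ⟨H, rfl⟩ : Polynomial.X ^ β ∣ P := by
    rw [Polynomial.X_pow_dvd_iff]
    intro j hj
    by_contra hne
    obtain ⟨i, hi⟩ := hP j hne
    rw [hPf i j hi] at hne
    have h1 := Nat.mul_le_mul_left c ((hedge i j hne).2 hi)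
    have h2 := Nat.mul_lt_mul_of_pos_left hj hα
    rw [mul_add, mul_comm α c] at hi
    omega
  have hcoeff (j : ℕ) : (Polynomial.X ^ β * H).coeff (j + β) = H.coeff j :=
    Polynomial.coeff_X_pow_mul H β j
  have hH0 : H.coeff 0 ≠ 0 := by
    rwa [← hcoeff, zero_add]
  have hHne : H ≠ 0 := by
    rintro rfl
    simp at hH0
  have hHdeg : H.natDegree = c := by
    rw [Polynomial.natDegree_mul (pow_ne_zero _ Polynomial.X_ne_zero) hHne,
      Polynomial.natDegree_X_pow] at hPdeg
    omega
  have hGdeg : (Polynomial.X ^ β : Polynomial K).natDegree = β := Polynomial.natDegree_X_pow β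
  have hcop : IsCoprime (Polynomial.X ^ β) H := by
    refine IsCoprime.pow_left ?_
    rw [Polynomial.irreducible_X.coprime_iff_not_dvd, Polynomial.X_dvd_iff]
    exact hH0
  refine not_irreducible_of_coprime_initial hc hα hcop (by omega) (by omega) ?_ ?_ f ?_ ?_
  · intro j hj
    rw [Polynomial.coeff_X_pow] at hj
    have : j = β := by
      by_contra h
      simp [h] at hj
    exact ⟨0, by rw [hGdeg, this]; ring⟩
  · intro j hj
    rw [← hcoeff] at hj
    obtain ⟨i, hi⟩ := hP _ hj
    refine ⟨i, ?_⟩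
    rw [mul_add, mul_add] at hi
    rw [hHdeg]
    omega
  · rw [hGdeg, hHdeg, ← mul_add]
    exact weightGE_of_forall_mem_supp fun i j hij => (hedge i j hij).1
  · rw [hGdeg, hHdeg, ← mul_add]
    exact hPf

lemma isDehomogenized_expand {a b : ℕ} (ha : 0 < a) (p : Polynomial K) :
    IsDehomogenized a b (b * (Polynomial.expand K a p).natDegree) (Polynomial.expand K a p) := by
  intro j hj
  rw [Polynomial.coeff_expand ha] at hj
  split_ifs at hj with h
  · obtain ⟨l, rfl⟩ := h
    rw [Nat.mul_div_cancel_left _ ha] at hj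
    obtain ⟨k, hk⟩ := Nat.exists_eq_add_of_le (Polynomial.le_natDegree_of_ne_zero hj)
    refine ⟨b * k, ?_⟩
    rw [Polynomial.natDegree_expand, hk]
    ring
  · exact absurd rfl hj

lemma homogenize_expand_mul {a b : ℕ} (ha : 0 < a) {p q : Polynomial K} (hp : p ≠ 0)
    (hq : q ≠ 0) :
    homogenize a b (b * (Polynomial.expand K a (p * q)).natDegree) (Polynomial.expand K a (p * q)) =
      homogenize a b (b * (Polynomial.expand K a p).natDegree) (Polynomial.expand K a p) *
        homogenize a b (b * (Polynomial.expand K a q).natDegree) (Polynomial.expand K a q) := by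
  rw [← homogenize_mul ha (isDehomogenized_expand ha p) le_rfl, ← map_mul, ← mul_add]
  simp only [Polynomial.natDegree_expand, Polynomial.natDegree_mul hp hq, add_mul]

/-- A polynomial whose exponents are the ordinates of the lattice points of a segment with
primitive direction `(b, -a)` is a polynomial in `y ^ a`. -/
lemma IsDehomogenized.expand_contract {a b N : ℕ} (ha : 0 < a) (hab : Nat.Coprime a b)
    (hN : a ∣ N) {p : Polynomial K} (hp : IsDehomogenized a b N p) :
    Polynomial.expand K a (Polynomial.contract a p) = p := by
  ext j
  rw [Polynomial.coeff_expand ha]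
  split_ifs with h
  · rw [Polynomial.coeff_contract ha.ne', Nat.div_mul_cancel h]
  · by_contra hne
    obtain ⟨i, hi⟩ := hp j (Ne.symm hne)
    rw [← hi] at hN
    exact h (hab.dvd_of_dvd_mul_left ((Nat.dvd_add_right (dvd_mul_right a i)).1 hN))

/-- If the Newton polygon is a single segment that is not primitive and the initial form is
squarefree, then the series is reducible. -/
lemma not_irreducible_of_squarefree_initial [IsAlgClosed K] {f : PS K} {a b d : ℕ} (ha : 0 < a)
    (hb : 0 < b) (hab : Nat.Coprime a b) (hd : 1 < d) (hn : (0, d * a) ∈ supp K f)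
    (hedge : ∀ i j, (i, j) ∈ supp K f → b * (d * a) ≤ a * i + b * j)
    (hsq : ∀ P : Polynomial K,
      (∀ i j, a * i + b * j = b * (d * a) → P.coeff j = coef K f (i, j)) →
      Squarefree (homogenize a b (b * (d * a)) P)) : ¬ Irreducible f := by
  obtain ⟨P, hP, hPf⟩ := exists_dehomogenize ha hb (b * (d * a)) f
  specialize hsq P hPf
  have hPn : P.coeff (d * a) ≠ 0 := by
    rw [hPf 0 (d * a) (by ring)]
    exact hn
  have hPdeg : P.natDegree = d * a :=
    le_antisymm (Nat.le_of_mul_le_mul_left hP.mul_natDegree_le hb)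
      (Polynomial.le_natDegree_of_ne_zero hPn)
  obtain ⟨Q, rfl⟩ : ∃ Q, Polynomial.expand K a Q = P :=
    ⟨_, hP.expand_contract ha hab ⟨b * d, by ring⟩⟩
  rw [← hPdeg] at hsq hedge hPf
  have hQdeg : Q.natDegree = d := by
    rw [Polynomial.natDegree_expand] at hPdeg
    exact Nat.eq_of_mul_eq_mul_right ha hPdeg
  have hQ0 : Q ≠ 0 := by
    rintro rfl
    simp at hQdeg
    omega
  obtain ⟨t, ht⟩ := IsAlgClosed.exists_root Q (by
    rw [Polynomial.degree_eq_natDegree hQ0, hQdeg]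
    exact_mod_cast (by omega : d ≠ 0))
  obtain ⟨R, rfl⟩ := Polynomial.dvd_iff_isRoot.2 ht
  have hL0 : (Polynomial.X - Polynomial.C t) ≠ 0 := Polynomial.X_sub_C_ne_zero t
  have hR0 : R ≠ 0 := right_ne_zero_of_mul hQ0
  have hRdeg : 1 + R.natDegree = d := by
    rwa [Polynomial.natDegree_mul hL0 hR0, Polynomial.natDegree_X_sub_C] at hQdeg
  have hGdeg : (Polynomial.expand K a (Polynomial.X - Polynomial.C t)).natDegree = a := by
    rw [Polynomial.natDegree_expand, Polynomial.natDegree_X_sub_C, one_mul]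
  by_cases hroot : Polynomial.X - Polynomial.C t ∣ R
  · obtain ⟨R', rfl⟩ := hroot
    rw [homogenize_expand_mul ha hL0 hR0,
      homogenize_expand_mul ha hL0 (right_ne_zero_of_mul hR0), ← mul_assoc] at hsq
    refine absurd (hsq _ (dvd_mul_right _ _)) ((weightGE_homogenize _ _).not_isUnit ?_)
    rw [hGdeg]
    positivity
  · have hcop := ((Polynomial.irreducible_X_sub_C t).coprime_iff_not_dvd.2 hroot).map
      (Polynomial.expand K a : Polynomial K →+* Polynomial K)
    have hdeg : b * (Polynomial.expand K a ((Polynomial.X - Polynomial.C t) * R)).natDegree =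
        b * (Polynomial.expand K a (Polynomial.X - Polynomial.C t)).natDegree +
          b * (Polynomial.expand K a R).natDegree := by
      simp only [Polynomial.natDegree_expand, Polynomial.natDegree_mul hL0 hR0]
      ring
    rw [hdeg] at hedge hPf
    rw [map_mul] at hPf
    refine not_irreducible_of_coprime_initial ha hb hcop ?_ ?_ (isDehomogenized_expand ha _)
      (isDehomogenized_expand ha _) f (weightGE_of_forall_mem_supp hedge) hPf
    · exact hGdeg.trans_ne ha.ne'
    · rw [RingHom.coe_coe, Polynomial.natDegree_expand]
      exact Nat.mul_ne_zero (by omega) ha.ne'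

end Irreducible

theorem gcd_eq_one_of_nondegenerate_irreducible (K : Type u) [Field K] [IsAlgClosed K]
    (f : PS K) (hnd : NonDegenerate K f) (hconv : Convenient K f) (hirr : Irreducible f) :
    Nat.gcd (ordX K f) (ordY K f) = 1 := by
  have hm : (ordX K f, 0) ∈ supp K f := Nat.sInf_mem hconv.1
  have hn : (0, ordY K f) ∈ supp K f := Nat.sInf_mem hconv.2
  have hmle (a : ℕ) (ha : (a, 0) ∈ supp K f) : ordX K f ≤ a := Nat.sInf_le ha
  have hnle (b : ℕ) (hb : (0, b) ∈ supp K f) : ordY K f ≤ b := Nat.sInf_le hb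
  have h00 : (0, 0) ∉ supp K f := fun h =>
    hirr.not_isUnit ((isUnit_iff_coef_zero_ne_zero f).2 h)
  generalize ordX K f = m at *
  generalize ordY K f = n at *
  have hm0 : 0 < m := Nat.pos_of_ne_zero (by rintro rfl; exact h00 hm)
  have hn0 : 0 < n := Nat.pos_of_ne_zero (by rintro rfl; exact h00 hn)
  obtain ⟨α, β, c, hα, hc, rfl, hαβ, hedge⟩ := exists_first_edge hm hn0 hnle
  rcases Nat.eq_zero_or_pos β with rfl | hβ
  swap
  · exact absurd hirr (not_irreducible_of_first_edge hα hc hβ hn hαβ hedge)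
  rw [zero_add] at *
  obtain rfl : m = α := by
    refine le_antisymm (hmle α hαβ) ?_
    have h := (hedge m 0 hm).1
    rw [mul_zero, add_zero, mul_comm] at h
    exact Nat.le_of_mul_le_mul_left h hc
  by_contra hgcd
  obtain ⟨d, a, b, hd, hab, rfl, rfl⟩ : ∃ d a b, 1 < d ∧ Nat.Coprime a b ∧ c = d * a ∧
      m = d * b := by
    have hpos : 0 < Nat.gcd m c := Nat.gcd_pos_of_pos_left c hm0
    exact ⟨Nat.gcd m c, c / Nat.gcd m c, m / Nat.gcd m c, by omega,
      (Nat.coprime_div_gcd_div_gcd hpos).symm, (Nat.mul_div_cancel' (Nat.gcd_dvd_right m c)).symm,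
      (Nat.mul_div_cancel' (Nat.gcd_dvd_left m c)).symm⟩
  have hd0 : 0 < d := by omega
  have ha : 0 < a := Nat.pos_of_mul_pos_left hc
  have hb : 0 < b := Nat.pos_of_mul_pos_left hm0
  let S : NEdge := ⟨(0, d * a), (d * b, 0), hm0, hc⟩
  have hS : S ∈ newtonPolygon K f := by
    refine ⟨hn, hm, (d * a, d * b), hc, hm0, ?_, fun p hp => ?_, fun p hp h => ?_⟩
    · simp only [S]
      ring
    · simpa [S] using (hedge p.1 p.2 hp).1
    · exact ⟨Nat.zero_le _, (hedge p.1 p.2 hp).2 (by simpa [S] using h)⟩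
  refine not_irreducible_of_squarefree_initial ha hb hab hd hn (fun i j hij => ?_)
    (fun P hP => ?_) hirr
  · have h := (hedge i j hij).1
    refine le_of_mul_le_mul_left ?_ hd0
    linarith
  · convert hnd S hS using 1
    refine ext_coef fun ⟨i, j⟩ => ?_
    rw [coef_homogenize, inBar, coef_ofCoef]
    have hiff : S.mem (i, j) ↔ a * i + b * j = b * (d * a) := by
      simp only [NEdge.mem, NEdge.len1, NEdge.len2, S, Nat.sub_zero, Nat.zero_le, true_and]
      constructor
      · rintro ⟨-, hj, h⟩
        obtain ⟨e, he⟩ := Nat.exists_eq_add_of_le hj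
        rw [he, Nat.add_sub_cancel_left, ← he] at h
        have h1 : a * i = b * e := Nat.eq_of_mul_eq_mul_left hd0 (by linarith)
        rw [h1, he]
        ring
      · intro h
        have hj : j ≤ d * a := le_of_mul_le_mul_left (by omega) hb
        obtain ⟨e, he⟩ := Nat.exists_eq_add_of_le hj
        have h1 : a * i = b * e := by
          rw [he, mul_add] at h
          omega
        refine ⟨le_of_mul_le_mul_left ?_ ha, hj, ?_⟩
        · calc a * i ≤ b * (d * a) := by omega
            _ = a * (d * b) := by ring
        · rw [he, Nat.add_sub_cancel_left, ← he]
          linear_combination d * h1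
    change _ = if S.mem (i, j) then coef K f (i, j) else 0
    simp only [hiff]
    split_ifs with h
    · exact hP i j h
    · rfl

end PlaneCurveNote
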